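/- For the Yang-Baxter-type map R defined on pairs of hyperplanes tangent to two fixed quadrics of a confocal family, the Yang-Baxter equation holds: R23 ∘ R13 ∘ R12 = R12 ∘ R13 ∘ R23 on triples of tangent hyperplanes, whenever all intermediate maps are defined. -/

import Mathlib

open Matrix

/-- Tangency of the hyperplane with covector `u` to the quadric whose dual quadric
has matrix `M`. -/
def Tang {n : ℕ} (M : Matrix (Fin n) (Fin n) ℂ) (u : Fin n → ℂ) : Prop :=
  M.mulVec u ⬝ᵥ u = 0

/-- `DRRel M1 M2 α β x y x' y'` expresses `(x', y') = R(x, y)` for the map `R`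
associated with the (dual) pencil of quadrics `M1 - λ•M2` of a confocal family:
`x` is tangent to the quadric of parameter `α`, `y` to that of parameter `β`,
and `x'`, `y'` are the unique hyperplanes of the pencil spanned by `x` and `y`,
other than `x` and `y`, tangent to those quadrics respectively. -/
def DRRel {n : ℕ} (M1 M2 : Matrix (Fin n) (Fin n) ℂ) (α β : ℂ)
    (x y x' y' : Fin n → ℂ) : Prop :=
  LinearIndependent ℂ ![x, y] ∧
  Tang (M1 - α • M2) x ∧ Tang (M1 - β • M2) y ∧
  x' ∈ Submodule.span ℂ {x, y} ∧ y' ∈ Submodule.span ℂ {x, y} ∧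
  x' ≠ 0 ∧ y' ≠ 0 ∧
  Tang (M1 - α • M2) x' ∧ Tang (M1 - β • M2) y' ∧
  (∀ c : ℂ, x' ≠ c • x) ∧ (∀ c : ℂ, y' ≠ c • y) ∧
  (∀ u ∈ Submodule.span ℂ {x, y}, u ≠ 0 → Tang (M1 - α • M2) u →
    (∃ c : ℂ, u = c • x) ∨ (∃ c : ℂ, u = c • x')) ∧
  (∀ u ∈ Submodule.span ℂ {x, y}, u ≠ 0 → Tang (M1 - β • M2) u →
    (∃ c : ℂ, u = c • y) ∨ (∃ c : ℂ, u = c • y'))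

section Reflection

variable {V : Type*} [AddCommGroup V] [Module ℂ V]

/-- The image of `x` under the reflection in `y` with respect to `A`, up to scaling. -/
def reflect (A : LinearMap.BilinForm ℂ V) (x y : V) : V :=
  A y y • x - (2 * A x y) • y

theorem reflect_smul (A : LinearMap.BilinForm ℂ V) (c d : ℂ) (x y : V) :
    reflect A (c • x) (d • y) = (c * d ^ 2) • reflect A x y := by
  simp only [reflect, map_smul, LinearMap.smul_apply, smul_eq_mul]
  module

/-- The identity behind the first component of the Yang–Baxter equation. -/
theorem reflect_first (f g : LinearMap.BilinForm ℂ V) (hf : f.IsSymm) (hg : g.IsSymm)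
    (α β γ : ℂ) (x y z : V) (hy : f y y = β * g y y)
    (hz : f z z = γ * g z z) :
    reflect (f - α • g) (reflect (f - α • g) x (reflect (f - γ • g) z y))
        (reflect (f - β • g) y z) =
      ((γ - β) ^ 2 * g y y * g z z + 4 * (f y z - β * g y z) * (f y z - γ * g y z)) ^ 2 •
        reflect (f - α • g) (reflect (f - α • g) x y) z := by
  have fzy : f z y = f y z := hf.eq z y
  have gzy : g z y = g y z := hg.eq z y
  simp only [reflect, map_sub, map_smul, LinearMap.sub_apply, LinearMap.smul_apply, smul_eq_mul,
    hy, hz, fzy, gzy]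
  module

/-- Up to scaling, the second component of both sides of the Yang–Baxter equation. -/
def commonSecond (f g : LinearMap.BilinForm ℂ V) (α β γ : ℂ) (x y z : V) : V :=
  let S := (β - α) * g y y * (f x z - γ * g x z) -
    2 * (f x y - α * g x y) * (f y z - γ * g y z)
  let T := (β - γ) * g y y * (f x z - α * g x z) -
    2 * (f x y - α * g x y) * (f y z - γ * g y z)
  let L := (α - γ) * g y y * ((α - β) * g x x * (f y z - β * g y z) -
    2 * (f x y - β * g x y) * (f x z - β * g x z)) - 2 * S * (f x y - β * g x y)
  let N := (γ - α) * g y y * ((γ - β) * g z z * (f x y - β * g x y) -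
    2 * (f y z - β * g y z) * (f x z - β * g x z)) - 2 * T * (f y z - β * g y z)
  (2 * (α - γ) * g y y * N) • x +
    ((γ - β) * (α - β) * (γ - α) ^ 2 * g x x * g y y ^ 2 * g z z + 4 * S * T) • y +
    (2 * (γ - α) * g y y * L) • z

theorem commonSecond_swap (f g : LinearMap.BilinForm ℂ V) (hf : f.IsSymm) (hg : g.IsSymm)
    (α β γ : ℂ) (x y z : V) :
    commonSecond f g γ β α z y x = commonSecond f g α β γ x y z := by
  have fyx : f y x = f x y := hf.eq y x
  have fzx : f z x = f x z := hf.eq z x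
  have fzy : f z y = f y z := hf.eq z y
  have gyx : g y x = g x y := hg.eq y x
  have gzx : g z x = g x z := hg.eq z x
  have gzy : g z y = g y z := hg.eq z y
  simp only [commonSecond, fyx, fzx, fzy, gyx, gzx, gzy]
  module

/-- The identity behind the second component of the Yang–Baxter equation. -/
theorem reflect_second (f g : LinearMap.BilinForm ℂ V) (hf : f.IsSymm) (hg : g.IsSymm)
    (α β γ : ℂ) (x y z : V) (hx : f x x = α * g x x) (hy : f y y = β * g y y)
    (hz : f z z = γ * g z z) :
    reflect (f - β • g) (reflect (f - β • g) y x)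
        (reflect (f - γ • g) z (reflect (f - α • g) x y)) =
      ((β - α) ^ 2 * g x x * g y y + 4 * (f x y - α * g x y) * (f x y - β * g x y)) ^ 2 •
        commonSecond f g α β γ x y z := by
  have fyx : f y x = f x y := hf.eq y x
  have fzx : f z x = f x z := hf.eq z x
  have fzy : f z y = f y z := hf.eq z y
  have gyx : g y x = g x y := hg.eq y x
  have gzx : g z x = g x z := hg.eq z x
  have gzy : g z y = g y z := hg.eq z y
  obtain ⟨K, hK⟩ : ∃ K, K = (β - α) ^ 2 * g x x * g y y +
    4 * (f x y - α * g x y) * (f x y - β * g x y) := ⟨_, rfl⟩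
  obtain ⟨S, hS⟩ : ∃ S, S = (β - α) * g y y * (f x z - γ * g x z) -
    2 * (f x y - α * g x y) * (f y z - γ * g y z) := ⟨_, rfl⟩
  obtain ⟨P, hP⟩ : ∃ P, P = (β - α) * g y y * (f x z - α * g x z) -
    2 * (f x y - α * g x y) * (f y z - α * g y z) := ⟨_, rfl⟩
  obtain ⟨L, hL⟩ : ∃ L, L = (α - γ) * g y y * ((α - β) * g x x * (f y z - β * g y z) -
    2 * (f x y - β * g x y) * (f x z - β * g x z)) - 2 * S * (f x y - β * g x y) := ⟨_, rfl⟩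
  have hX : reflect (f - α • g) x y =
      ((β - α) * g y y) • x - (2 * (f x y - α * g x y)) • y := by
    simp only [reflect, LinearMap.sub_apply, LinearMap.smul_apply, smul_eq_mul, hy]
    module
  have hY : reflect (f - β • g) y x =
      ((α - β) * g x x) • y - (2 * (f x y - β * g x y)) • x := by
    simp only [reflect, LinearMap.sub_apply, LinearMap.smul_apply, smul_eq_mul, hx, fyx, gyx]
    module
  have hZ : reflect (f - γ • g) z (reflect (f - α • g) x y) =
      ((α - γ) * g y y * K) • z -
        (2 * S) • (((β - α) * g y y) • x - (2 * (f x y - α * g x y)) • y) := by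
    rw [hX, hK, hS]
    simp only [reflect, map_sub, map_smul, LinearMap.sub_apply, LinearMap.smul_apply,
      smul_eq_mul, hx, hy, fyx, fzx, fzy, gyx, gzx, gzy]
    module
  have hBZ : (f - β • g) (reflect (f - γ • g) z (reflect (f - α • g) x y))
      (reflect (f - γ • g) z (reflect (f - α • g) x y)) =
        (γ - β) * g y y * K * ((γ - α) ^ 2 * g y y * K * g z z + 4 * P * S) := by
    rw [hZ]
    simp only [map_sub, map_smul, LinearMap.sub_apply, LinearMap.smul_apply,
      smul_eq_mul, hx, hy, hz, fyx, fzx, fzy, gyx, gzx, gzy]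
    linear_combination (-4 * S ^ 2 * (α - β) * g y y) * hK + (4 * g y y * K * S * (α - β)) * hS -
      (4 * g y y * K * S * (γ - β)) * hP
  have hBYZ : (f - β • g) (reflect (f - β • g) y x)
      (reflect (f - γ • g) z (reflect (f - α • g) x y)) = K * L := by
    rw [hZ, hY, hL]
    simp only [map_sub, map_smul, LinearMap.sub_apply, LinearMap.smul_apply,
      smul_eq_mul, hx, hy, fyx, gyx]
    linear_combination (2 * S * (f x y - β * g x y)) * hK
  rw [← hK, reflect, hBZ, hBYZ, hY, hZ]
  simp only [commonSecond, ← hS, ← hL]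
  match_scalars
  · rw [hL, hP]
    rw [hS, hK]
    ring
  · rw [hL, hP]
    rw [hS, hK]
    ring
  · ring

/-- Two vectors are nonzero multiples of each other. -/
def ProjEq (u v : V) : Prop :=
  ∃ c : ℂ, c ≠ 0 ∧ u = c • v

theorem ProjEq.symm {u v : V} : ProjEq u v → ProjEq v u := by
  rintro ⟨c, hc, rfl⟩
  exact ⟨c⁻¹, inv_ne_zero hc, by rw [smul_smul, inv_mul_cancel₀ hc, one_smul]⟩

theorem ProjEq.trans {u v w : V} : ProjEq u v → ProjEq v w → ProjEq u w := by
  rintro ⟨c, hc, rfl⟩ ⟨d, hd, rfl⟩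
  exact ⟨c * d, mul_ne_zero hc hd, smul_smul c d w⟩

theorem ProjEq.of_smul {u v : V} {c : ℂ} (h : ProjEq u (c • v)) (hu : u ≠ 0) : ProjEq u v := by
  obtain ⟨d, hd, rfl⟩ := h
  exact ⟨d * c, fun h0 => hu (by rw [smul_smul, h0, zero_smul]), smul_smul d c v⟩

theorem ProjEq.reflect {u u' v v' : V} (A : LinearMap.BilinForm ℂ V) :
    ProjEq u u' → ProjEq v v' → ProjEq (reflect A u v) (reflect A u' v') := by
  rintro ⟨c, hc, rfl⟩ ⟨d, hd, rfl⟩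
  exact ⟨c * d ^ 2, mul_ne_zero hc (pow_ne_zero 2 hd), reflect_smul A c d u' v'⟩

/-- On a line that is not contained in the quadric `A = 0`, the second intersection point
is given by the reflection. -/
theorem projEq_reflect_of_mem_span {A : LinearMap.BilinForm ℂ V} (hA : A.IsSymm) {x y x' : V}
    (hxy : LinearIndependent ℂ ![x, y]) (hx : A x x = 0)
    (hmem : x' ∈ Submodule.span ℂ {x, y}) (hx' : A x' x' = 0) (hne : ∀ c : ℂ, x' ≠ c • x)
    (huniq : ∀ u ∈ Submodule.span ℂ {x, y}, u ≠ 0 → A u u = 0 →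
      (∃ c : ℂ, u = c • x) ∨ (∃ c : ℂ, u = c • x')) :
    ProjEq x' (reflect A x y) := by
  obtain ⟨s, t, rfl⟩ := Submodule.mem_span_pair.mp hmem
  have hyx : A y x = A x y := hA.eq y x
  have key (a b : ℂ) : A (a • x + b • y) (a • x + b • y) = b * (2 * a * A x y + b * A y y) := by
    simp only [map_add, map_smul, LinearMap.add_apply, LinearMap.smul_apply, smul_eq_mul, hx, hyx]
    ring
  have ht : t ≠ 0 := by
    rintro rfl
    exact hne s (by simp)
  rw [key] at hx'
  have hst := (mul_eq_zero.mp hx').resolve_left ht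
  rw [LinearIndependent.pair_iff] at hxy
  have hc : A x y ≠ 0 := by
    intro h0
    have hyy : A y y = 0 := by simpa [h0, ht] using hst
    have hk (k : ℂ) (hk0 : k ≠ 0) : t = k * s := by
      have h1 : (1 : ℂ) • x + k • y ≠ 0 := fun h => one_ne_zero (hxy _ _ h).1
      rcases huniq _ (Submodule.mem_span_pair.mpr ⟨1, k, rfl⟩) h1 (by rw [key, h0, hyy]; ring) with
        ⟨c, h⟩ | ⟨c, h⟩
      · exact absurd (hxy (1 - c) k (by linear_combination (norm := module) h)).2 hk0
      · obtain ⟨e1, e2⟩ := hxy (1 - c * s) (k - c * t) (by linear_combination (norm := module) h)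
        have hc : c ≠ 0 := by
          rintro rfl
          simp at e1
        apply mul_left_cancel₀ hc
        linear_combination k * e1 - e2
    have e1 := hk 1 one_ne_zero
    have e2 := hk 2 two_ne_zero
    exact ht (by linear_combination 2 * e1 - e2)
  refine ⟨-t / (2 * A x y), div_ne_zero (neg_ne_zero.mpr ht) (mul_ne_zero two_ne_zero hc), ?_⟩
  rw [_root_.reflect]
  match_scalars
  · field_simp
    linear_combination hst
  · field_simp

end Reflection

section Tangency

variable {n : ℕ} {M1 M2 : Matrix (Fin n) (Fin n) ℂ} {α β γ : ℂ}

theorem tang_iff (M : Matrix (Fin n) (Fin n) ℂ) (u : Fin n → ℂ) :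
    Tang M u ↔ M.toBilin' u u = 0 := by
  rw [Tang, Matrix.toBilin'_apply', dotProduct_comm]

theorem toBilin'_sub_smul :
    (M1 - α • M2).toBilin' = M1.toBilin' - α • M2.toBilin' := by
  rw [map_sub, map_smul]

theorem isSymm_toBilin' (h : M1.IsSymm) : M1.toBilin'.IsSymm := by
  refine ⟨fun u v => ?_⟩
  rw [Matrix.toBilin'_apply', Matrix.toBilin'_apply', dotProduct_mulVec,
    ← mulVec_transpose, h.eq, dotProduct_comm]

theorem tang_sub_smul_iff {u : Fin n → ℂ} :
    Tang (M1 - α • M2) u ↔ M1.toBilin' u u = α * M2.toBilin' u u := by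
  rw [tang_iff, toBilin'_sub_smul, LinearMap.sub_apply, LinearMap.sub_apply,
    LinearMap.smul_apply, LinearMap.smul_apply, smul_eq_mul, sub_eq_zero]

theorem DRRel.symm {x y x' y' : Fin n → ℂ} (h : DRRel M1 M2 α β x y x' y') :
    DRRel M1 M2 β α y x y' x' := by
  obtain ⟨hli, hx, hy, mx, my, nx, ny, tx, ty, dx, dy, ux, uy⟩ := h
  rw [DRRel, Set.pair_comm y x, LinearIndependent.pair_symm_iff]
  exact ⟨hli, hy, hx, my, mx, ny, nx, ty, tx, dy, dx, uy, ux⟩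

theorem DRRel.projEq_reflect {x y x' y' : Fin n → ℂ} (h1 : M1.IsSymm) (h2 : M2.IsSymm)
    (h : DRRel M1 M2 α β x y x' y') :
    ProjEq x' (reflect (M1.toBilin' - α • M2.toBilin') x y) := by
  obtain ⟨hli, hx, -, mx, -, -, -, tx, -, dx, -, ux, -⟩ := h
  have hs : (M1 - α • M2).IsSymm := h1.sub (h2.smul α)
  rw [← toBilin'_sub_smul]
  simp only [tang_iff] at hx tx ux
  exact projEq_reflect_of_mem_span (isSymm_toBilin' hs) hli hx mx tx dx ux

/-- The first components of the two sides of the Yang–Baxter equation agree. -/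
theorem yangBaxter_first (h1 : M1.IsSymm) (h2 : M2.IsSymm)
    {x y z x2 y1 x23 z1 y3 z2 x3 z12' x23' y13' : Fin n → ℂ}
    (r12 : DRRel M1 M2 α β x y x2 y1) (r13 : DRRel M1 M2 α γ x2 z x23 z1)
    (r23' : DRRel M1 M2 β γ y z y3 z2) (r13' : DRRel M1 M2 α γ x z2 x3 z12')
    (r12' : DRRel M1 M2 α β x3 y3 x23' y13') :
    ProjEq x23' x23 := by
  have refl (u : Fin n → ℂ) : ProjEq u u := ⟨1, one_ne_zero, (one_smul ℂ u).symm⟩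
  have hl := (r13.projEq_reflect h1 h2).trans ((r12.projEq_reflect h1 h2).reflect _ (refl z))
  have hr := (r12'.projEq_reflect h1 h2).trans
    (((r13'.projEq_reflect h1 h2).trans
      ((refl x).reflect _ (r23'.symm.projEq_reflect h1 h2))).reflect _
        (r23'.projEq_reflect h1 h2))
  rw [reflect_first _ _ (isSymm_toBilin' h1) (isSymm_toBilin' h2) α β γ x y z
    (tang_sub_smul_iff.mp r23'.2.1) (tang_sub_smul_iff.mp r23'.2.2.1)] at hr
  exact (hr.of_smul r12'.2.2.2.2.2.1).trans hl.symm

/-- The second component of the left-hand side of the Yang–Baxter equation. -/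
theorem projEq_commonSecond (h1 : M1.IsSymm) (h2 : M2.IsSymm)
    {x y z x2 y1 x23 z1 y13 z12 : Fin n → ℂ}
    (r12 : DRRel M1 M2 α β x y x2 y1) (r13 : DRRel M1 M2 α γ x2 z x23 z1)
    (r23 : DRRel M1 M2 β γ y1 z1 y13 z12) :
    ProjEq y13 (commonSecond M1.toBilin' M2.toBilin' α β γ x y z) := by
  have refl (u : Fin n → ℂ) : ProjEq u u := ⟨1, one_ne_zero, (one_smul ℂ u).symm⟩
  have h := (r23.projEq_reflect h1 h2).trans
    ((r12.symm.projEq_reflect h1 h2).reflect _ ((r13.symm.projEq_reflect h1 h2).trans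
      ((refl z).reflect _ (r12.projEq_reflect h1 h2))))
  rw [reflect_second _ _ (isSymm_toBilin' h1) (isSymm_toBilin' h2) α β γ x y z
    (tang_sub_smul_iff.mp r12.2.1) (tang_sub_smul_iff.mp r12.2.2.1)
    (tang_sub_smul_iff.mp r13.2.2.1)] at h
  exact h.of_smul r23.2.2.2.2.2.1

end Tangency

/-- The Yang–Baxter equation `R23 ∘ R13 ∘ R12 = R12 ∘ R13 ∘ R23` holds for the map `R`
on pairs of hyperplanes tangent to quadrics of a confocal family (dual pencil
`M1 - λ•M2`), whenever all intermediate maps are defined: the two ways of evolving the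
triple `(x, y, z)` produce projectively equal results. -/
theorem stmt_7 (n : ℕ) (M1 M2 : Matrix (Fin (n + 1)) (Fin (n + 1)) ℂ)
    (h1 : M1.IsSymm) (h2 : M2.IsSymm) (α β γ : ℂ)
    (x y z x2 y1 x23 z1 y13 z12 y3 z2 x3 z12' x23' y13' : Fin (n + 1) → ℂ)
    -- left-hand side R23 ∘ R13 ∘ R12 :
    (r12 : DRRel M1 M2 α β x y x2 y1)
    (r13 : DRRel M1 M2 α γ x2 z x23 z1)
    (r23 : DRRel M1 M2 β γ y1 z1 y13 z12)
    -- right-hand side R12 ∘ R13 ∘ R23 :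
    (r23' : DRRel M1 M2 β γ y z y3 z2)
    (r13' : DRRel M1 M2 α γ x z2 x3 z12')
    (r12' : DRRel M1 M2 α β x3 y3 x23' y13') :
    (∃ c : ℂ, c ≠ 0 ∧ x23' = c • x23) ∧
    (∃ c : ℂ, c ≠ 0 ∧ y13' = c • y13) ∧
    (∃ c : ℂ, c ≠ 0 ∧ z12' = c • z12) := by
  refine ⟨yangBaxter_first h1 h2 r12 r13 r23' r13' r12', ?_, ?_⟩
  · have h := projEq_commonSecond h1 h2 r23'.symm r13'.symm r12'.symm
    rw [commonSecond_swap _ _ (isSymm_toBilin' h1) (isSymm_toBilin' h2)] at h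
    exact h.trans (projEq_commonSecond h1 h2 r12 r13 r23).symm
  · exact (yangBaxter_first h1 h2 r23'.symm r13'.symm r12.symm r13.symm r23.symm).symm
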